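/- For all M ≥ 1 and n ≥ 1, the infimum, over all hypergraphs H on [n] (not necessarily inclusion-free) and all strictly increasing functions f: [M] → ℝ with nonnegative values, of the number of isolating weights |Z(H,M,f)| equals (M−1)^n. In particular, |Z(H,M,f)| ≥ (M−1)^n for every such H and f, and there exist a hypergraph H (the full power set of [n]) and a nonnegative strictly increasing f (namely f(i) = i−1) with |Z(H,M,f)| ≤ (M−1)^n. -/

import Mathlib

open Finset

/-- The weight of an edge `e` under vertex-weight function `w` and objective function `f`:
`fw(e) = ∑_{i ∈ e} f(w(i))`. -/
def edgeW {V : Type*} (f : ℕ → ℝ) (w : V → ℕ) (e : Finset V) : ℝ :=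
  ∑ i ∈ e, f (w i)

/-- A hypergraph is inclusion-free if no edge is a proper subset of another edge. -/
def InclFree {V : Type*} (H : Finset (Finset V)) : Prop :=
  ∀ e ∈ H, ∀ e' ∈ H, ¬ e ⊂ e'

/-- `f` is an objective function for `[M]`: strictly increasing with strictly positive
values on `{1, …, M}`. -/
def Objective (M : ℕ) (f : ℕ → ℝ) : Prop :=
  StrictMonoOn f (Set.Icc 1 M) ∧ ∀ i ∈ Set.Icc 1 M, (0 : ℝ) < f i

/-- `w` is isolating for `H, f`: there is exactly one edge `e ∈ H` with
`fw(e) < fw(e')` for all edges `e' ≠ e`.  By convention every weight is isolating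
for the empty hypergraph. -/
def Isolating {V : Type*} (H : Finset (Finset V)) (f : ℕ → ℝ) (w : V → ℕ) : Prop :=
  H = ∅ ∨ ∃! e, e ∈ H ∧ ∀ e' ∈ H, e' ≠ e → edgeW f w e < edgeW f w e'

/-- `Z(H, M, f)`: the set of isolating weights `w : V → {1, …, M}`. -/
def Zset {V : Type*} (M : ℕ) (H : Finset (Finset V)) (f : ℕ → ℝ) : Set (V → ℕ) :=
  {w | (∀ i, 1 ≤ w i ∧ w i ≤ M) ∧ Isolating H f w}

/-- `Z_j(H, M, f)`: the set of isolating weights `w ∈ [M]^V` whose minimum entry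
(layer) equals `j`. -/
def Zlayer {V : Type*} (M j : ℕ) (H : Finset (Finset V)) (f : ℕ → ℝ) : Set (V → ℕ) :=
  {w | w ∈ Zset M H f ∧ (∀ i, j ≤ w i) ∧ ∃ i, w i = j}

/-- `f` is a nonnegative objective function for `[M]`: strictly increasing with
nonnegative (zero allowed) values on `{1, …, M}`. -/
def ObjectiveNN (M : ℕ) (f : ℕ → ℝ) : Prop :=
  StrictMonoOn f (Set.Icc 1 M) ∧ ∀ i ∈ Set.Icc 1 M, (0 : ℝ) ≤ f i

/-- Lower every vertex of `e` by one. -/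
def lowerOn {V : Type*} [DecidableEq V] (w : V → ℕ) (e : Finset V) : V → ℕ :=
  fun i => if i ∈ e then w i - 1 else w i

/-- Lowering a minimum-weight edge by one makes it the strict minimum. -/
theorem edgeW_lowerOn_lt {V : Type*} [DecidableEq V] {M : ℕ} {f : ℕ → ℝ}
    (hf : ObjectiveNN M f) {w : V → ℕ} (hw : ∀ i, 2 ≤ w i ∧ w i ≤ M) {e e' : Finset V}
    (hle : edgeW f w e ≤ edgeW f w e') (hne : e' ≠ e) :
    edgeW f (lowerOn w e) e < edgeW f (lowerOn w e) e' := by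
  obtain ⟨hmono, hnonneg⟩ := hf
  have hdrop : ∀ i, f (w i - 1) < f (w i) := fun i => by
    have := hw i
    exact hmono ⟨by omega, by omega⟩ ⟨by omega, by omega⟩ (by omega)
  have hpos : ∀ i, 0 < f (w i) := fun i => by
    have := hw i
    exact (hnonneg (w i - 1) ⟨by omega, by omega⟩).trans_lt (hdrop i)
  have hinter : ∀ s : Finset V, edgeW f (lowerOn w e) s =
      edgeW f w s - ∑ i ∈ s ∩ e, (f (w i) - f (w i - 1)) := fun s => by
    rw [edgeW, edgeW, ← Finset.sum_ite_mem, ← Finset.sum_sub_distrib]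
    refine Finset.sum_congr rfl fun i _ => ?_
    by_cases h : i ∈ e <;> simp [lowerOn, h]
  rw [hinter, hinter, Finset.inter_self]
  by_cases hsub : e ⊆ e'
  · rw [Finset.inter_eq_right.mpr hsub]
    have hlt : edgeW f w e < edgeW f w e' := by
      obtain ⟨j, hj, hje⟩ := Finset.exists_of_ssubset (hsub.ssubset_of_ne hne.symm)
      exact Finset.sum_lt_sum_of_subset hsub hj hje (hpos j) fun i _ _ => (hpos i).le
    linarith
  · obtain ⟨j, hj, hje⟩ := Finset.not_subset.mp hsub
    have hlt : ∑ i ∈ e' ∩ e, (f (w i) - f (w i - 1)) < ∑ i ∈ e, (f (w i) - f (w i - 1)) :=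
      Finset.sum_lt_sum_of_subset Finset.inter_subset_right hj (by simp [hje])
        (sub_pos.mpr (hdrop j)) fun i _ _ => (sub_pos.mpr (hdrop i)).le
    linarith

theorem finite_Zset {V : Type*} [Fintype V] (M : ℕ) (H : Finset (Finset V)) (f : ℕ → ℝ) :
    (Zset M H f).Finite :=
  (Set.Finite.pi' fun _ : V => Set.finite_Icc 1 M).subset fun _ hw i => hw.1 i

theorem ncard_weights_ge_two {V : Type*} [Fintype V] (M : ℕ) :
    {w : V → ℕ | ∀ i, 2 ≤ w i ∧ w i ≤ M}.ncard = (M - 1) ^ Fintype.card V := by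
  classical
  have h : {w : V → ℕ | ∀ i, 2 ≤ w i ∧ w i ≤ M} =
      ↑(Fintype.piFinset fun _ : V => Finset.Icc 2 M) := by
    ext w
    simp only [Set.mem_ofPred_eq, Finset.mem_coe, Fintype.mem_piFinset, Finset.mem_Icc]
  rw [h, Set.ncard_coe_finset, Fintype.card_piFinset, Finset.prod_const, Nat.card_Icc,
    Finset.card_univ]
  rfl

/-- Every hypergraph has at least `(M - 1) ^ n` isolating weights for a nonnegative
objective function. -/
theorem pow_le_ncard_Zset {V : Type*} [Fintype V] {M : ℕ} (H : Finset (Finset V))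
    {f : ℕ → ℝ} (hf : ObjectiveNN M f) :
    (M - 1) ^ Fintype.card V ≤ (Zset M H f).ncard := by
  classical
  rw [← ncard_weights_ge_two]
  rcases H.eq_empty_or_nonempty with rfl | hH
  · exact Set.ncard_le_ncard
      (fun w hw => ⟨fun i => ⟨one_le_two.trans (hw i).1, (hw i).2⟩, Or.inl rfl⟩)
      (finite_Zset M ∅ f)
  choose e he hmin using fun w : V → ℕ => H.exists_min_image (edgeW f w) hH
  have hstrict : ∀ w : V → ℕ, (∀ i, 2 ≤ w i ∧ w i ≤ M) → ∀ e' ∈ H, e' ≠ e w →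
      edgeW f (lowerOn w (e w)) (e w) < edgeW f (lowerOn w (e w)) e' :=
    fun w hw e' he' hne => edgeW_lowerOn_lt hf hw (hmin w e' he') hne
  refine Set.ncard_le_ncard_of_injOn (fun w => lowerOn w (e w)) ?_ ?_ (finite_Zset M H f)
  · intro w hw
    refine ⟨fun i => ?_, Or.inr ⟨e w, ⟨he w, hstrict w hw⟩, fun e' h => ?_⟩⟩
    · have := hw i
      dsimp only [lowerOn]
      split_ifs <;> omega
    · by_contra hne
      exact lt_asymm (hstrict w hw e' h.1 hne) (h.2 (e w) (he w) (Ne.symm hne))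
  · intro w hw v hv hwv
    dsimp only at hwv
    have hev : e w = e v := by
      by_contra hne
      have h₁ := hstrict w hw (e v) (he v) (Ne.symm hne)
      have h₂ := hstrict v hv (e w) (he w) hne
      rw [hwv] at h₁
      exact lt_asymm h₁ h₂
    ext i
    have hi := congrFun hwv i
    have hwi := hw i
    have hvi := hv i
    rw [hev] at hi
    dsimp only [lowerOn] at hi
    split_ifs at hi <;> omega

theorem objectiveNN_sub_one (M : ℕ) : ObjectiveNN M (fun i => (i : ℝ) - 1) := by
  refine ⟨fun a _ b _ hab => ?_, fun i hi => ?_⟩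
  · simpa using hab
  · simpa using hi.1

/-- For the full power set and `f i = i - 1`, isolating weights never take the value `1`. -/
theorem ncard_Zset_univ_le {V : Type*} [Fintype V] [DecidableEq V] (M : ℕ) :
    (Zset M (Finset.univ : Finset (Finset V)) (fun i => (i : ℝ) - 1)).ncard ≤
      (M - 1) ^ Fintype.card V := by
  rw [← ncard_weights_ge_two]
  refine Set.ncard_le_ncard ?_
    ((Set.Finite.pi' fun _ : V => Set.finite_Icc 2 M).subset fun _ hw i => hw i)
  rintro w ⟨hw, hiso⟩ i
  refine ⟨?_, (hw i).2⟩
  by_contra hlt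
  have hwi : w i = 1 := by have := hw i; omega
  obtain hempty | ⟨e, ⟨-, hmin⟩, -⟩ := hiso
  · exact Finset.univ_nonempty.ne_empty hempty
  have hnonneg : 0 ≤ edgeW (fun i => (i : ℝ) - 1) w e :=
    Finset.sum_nonneg fun j _ => by simpa using (hw j).1
  by_cases he : e = ∅
  · have h := hmin {i} (Finset.mem_univ _) (by simp [he])
    simp [he, edgeW, hwi] at h
  · have h := hmin ∅ (Finset.mem_univ _) (Ne.symm he)
    have h0 : edgeW (fun i => (i : ℝ) - 1) w ∅ = 0 := Finset.sum_empty
    linarith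

/-- Proposition 26 of the paper; zero weights allowed.  For
`M ≥ 1` and `n ≥ 1`, the infimum, over all hypergraphs `H` on `[n]` (not
necessarily inclusion-free) and all strictly increasing nonnegative `f : [M] → ℝ`,
of `|Z(H,M,f)|` equals `(M-1)^n`.  In particular `|Z(H,M,f)| ≥ (M-1)^n` always,
and the full power set together with `f(i) = i - 1` achieves `|Z(H,M,f)| ≤ (M-1)^n`. -/
theorem stmt_19 (M n : ℕ) (hM : 1 ≤ M) (hn : 1 ≤ n) :
    sInf {k | ∃ (H : Finset (Finset (Fin n))) (f : ℕ → ℝ),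
        ObjectiveNN M f ∧ k = (Zset M H f).ncard} = (M - 1) ^ n ∧
      (∀ (H : Finset (Finset (Fin n))) (f : ℕ → ℝ), ObjectiveNN M f →
        (M - 1) ^ n ≤ (Zset M H f).ncard) ∧
      (ObjectiveNN M (fun i => (i : ℝ) - 1) ∧
        (Zset M (Finset.univ : Finset (Finset (Fin n))) (fun i => (i : ℝ) - 1)).ncard ≤
          (M - 1) ^ n) := by
  have hlower : ∀ (H : Finset (Finset (Fin n))) (f : ℕ → ℝ), ObjectiveNN M f →
      (M - 1) ^ n ≤ (Zset M H f).ncard := fun H f hf => by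
    simpa using pow_le_ncard_Zset H hf
  have hupper : (Zset M (Finset.univ : Finset (Finset (Fin n)))
      (fun i => (i : ℝ) - 1)).ncard ≤ (M - 1) ^ n := by
    simpa using ncard_Zset_univ_le (V := Fin n) M
  refine ⟨le_antisymm ?_ ?_, hlower, objectiveNN_sub_one M, hupper⟩
  · refine le_trans (Nat.sInf_le ?_) hupper
    exact ⟨Finset.univ, _, objectiveNN_sub_one M, rfl⟩
  · refine le_csInf ⟨_, ⟨Finset.univ, _, objectiveNN_sub_one M, rfl⟩⟩ ?_
    rintro k ⟨H, f, hf, rfl⟩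
    exact hlower H f hf
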